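/- Let C₁ = K(x₁, r₁), C₂ = K(x₂, r₂), C₃ = K(x₃, r₃) be pairwise distinct circles with rᵢ > 0, and suppose it is not the case that the three circles are pairwise tangent with a common point (i.e. there is no point p lying on all three circles such that each pair of the circles meets in exactly one point). Then the set of solutions of the Apollonius problem for (C₁, C₂, C₃) is finite, has at most 8 elements, and its cardinality is never equal to 7 and never equal to 1. -/

import Mathlib

open RealInnerProductSpace

noncomputable section

/-- The Euclidean plane. -/
abbrev Pl := EuclideanSpace ℝ (Fin 2)

/-- The circle of center `x` and radius `r` in the Euclidean plane. -/
def K (x : Pl) (r : ℝ) : Set Pl := {p | dist p x = r}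

/-- Two circles, given by centers and (positive) radii, are tangent. -/
def CircleTangent (y : Pl) (s : ℝ) (x : Pl) (r : ℝ) : Prop :=
  dist y x = s + r ∨ dist y x = |s - r|

/-- A line (a 1-dimensional affine subspace of the plane) is tangent to a circle iff it
meets it in exactly one point. -/
def LineTangent (L : AffineSubspace ℝ Pl) (x : Pl) (r : ℝ) : Prop :=
  ∃! p, p ∈ (L : Set Pl) ∩ K x r

/-- Solutions of the Apollonius problem for three circles with centers `x i` and radii
`r i`: a solution is either a circle `(y, s)` with `s > 0` tangent to all three, or a
line (1-dimensional affine subspace) tangent to all three, or a point lying on all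
three. The solution set is the disjoint union (sum type) of these three sets. -/
def ApolloniusSolutions (x : Fin 3 → Pl) (r : Fin 3 → ℝ) : Type :=
  {ys : Pl × ℝ // 0 < ys.2 ∧ ∀ i, CircleTangent ys.1 ys.2 (x i) (r i)} ⊕
  {L : AffineSubspace ℝ Pl // Module.finrank ℝ L.direction = 1 ∧
    ∀ i, LineTangent L (x i) (r i)} ⊕
  {p : Pl // ∀ i, p ∈ K (x i) (r i)}


lemma sq_zero_left (a b : ℝ) (h : a^2 + b^2 = 0^2) : a = 0 := by
  nlinarith [sq_nonneg a, sq_nonneg b]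

def EE (w1 w2 ω : ℝ) : Set (ℝ × ℝ) := {z | z.1^2 + z.2^2 = 1 ∧ w1 * z.1 + w2 * z.2 = ω}

lemma EE_card (w1 w2 ω : ℝ) (h : ¬ (w1 = 0 ∧ w2 = 0 ∧ ω = 0)) :
    (EE w1 w2 ω).Finite ∧ (EE w1 w2 ω).ncard ≤ 2 ∧
      ((EE w1 w2 ω).ncard = 1 ↔ w1^2 + w2^2 - ω^2 = 0) := by
  by_cases hD : w1^2 + w2^2 = 0
  · have h1 : w1 = 0 := by nlinarith [sq_nonneg w1, sq_nonneg w2]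
    have h2 : w2 = 0 := by nlinarith [sq_nonneg w1, sq_nonneg w2]
    have h3 : ω ≠ 0 := fun h3 => h ⟨h1, h2, h3⟩
    have : EE w1 w2 ω = ∅ := by
      ext z
      simp only [EE, Set.mem_ofPred_eq, Set.mem_empty_iff_false, iff_false, not_and]
      intro _ h5
      apply h3
      rw [← h5, h1, h2]; ring
    rw [this]
    simp [h1, h2, h3]
  · have hpos : 0 < w1^2 + w2^2 := lt_of_le_of_ne (by positivity) (Ne.symm hD)
    have key : ∀ z ∈ EE w1 w2 ω, (w1 * z.2 - w2 * z.1)^2 = w1^2 + w2^2 - ω^2 := by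
      rintro z ⟨a, b⟩
      rw [← b]
      linear_combination (w1^2+w2^2) * a
    rcases lt_or_ge (w1^2 + w2^2 - ω^2) 0 with hd | hd
    · have : EE w1 w2 ω = ∅ := by
        ext z
        simp only [Set.mem_empty_iff_false, iff_false]
        intro hz
        nlinarith [key z hz, sq_nonneg (w1 * z.2 - w2 * z.1)]
      rw [this]
      simp [hd.ne]
    · set κ := Real.sqrt (w1^2 + w2^2 - ω^2) with hκ
      have hk2 : κ^2 = w1^2 + w2^2 - ω^2 := Real.sq_sqrt hd
      have hE : EE w1 w2 ω = {((ω * w1 - κ * w2)/(w1^2+w2^2), (ω * w2 + κ * w1)/(w1^2+w2^2)),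
          ((ω * w1 + κ * w2)/(w1^2+w2^2), (ω * w2 - κ * w1)/(w1^2+w2^2))} := by
        ext ⟨a, b⟩
        simp only [Set.mem_insert_iff, Set.mem_singleton_iff, Prod.mk.injEq]
        constructor
        · intro hz
          have hk := key _ hz
          obtain ⟨h1, h2⟩ := hz
          simp only at hk h1 h2
          rw [← hk2, sq_eq_sq_iff_eq_or_eq_neg] at hk
          rcases hk with hk | hk
          · left; constructor <;> rw [eq_div_iff hD, ← h2, ← hk] <;> ring
          · right
            have hk : κ = -(w1 * b - w2 * a) := by linarith
            constructor <;> rw [eq_div_iff hD, ← h2, hk] <;> ring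
        · have hk2' := hk2
          rintro (⟨rfl, rfl⟩ | ⟨rfl, rfl⟩)
          · constructor
            · simp only
              rw [div_pow, div_pow, ← add_div, div_eq_one_iff_eq (by positivity)]
              linear_combination (w1^2+w2^2) * hk2
            · simp only
              field_simp
              ring
          · constructor
            · simp only
              rw [div_pow, div_pow, ← add_div, div_eq_one_iff_eq (by positivity)]
              linear_combination (w1^2+w2^2) * hk2
            · simp only
              field_simp
              ring
      rw [hE]
      refine ⟨Set.toFinite _, (Set.ncard_insert_le _ _).trans (by rw [Set.ncard_singleton]), ?_⟩
      rw [← hk2]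
      constructor
      · intro h1
        by_contra hne
        have hκ0 : κ ≠ 0 := fun h0 => hne (by rw [h0]; ring)
        rw [Set.ncard_pair] at h1
        · omega
        · simp only [ne_eq, Prod.mk.injEq, not_and, div_left_inj' hD]
          intro e1 e2
          have e1 : κ * w2 = 0 := by linarith
          have e2 : κ * w1 = 0 := by linarith
          simp only [mul_eq_zero, hκ0, false_or] at e1 e2
          apply hD
          rw [e1, e2]; ring
      · intro h0
        have h0 : κ = 0 := by simpa using h0
        rw [h0]
        simp

def Circ (p1 q1 p2 q2 p3 q3 ρ1 ρ2 ρ3 : ℝ) : Set (ℝ × ℝ × ℝ) :=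
  {z | (z.1 - p1)^2 + (z.2.1 - q1)^2 = (z.2.2 - ρ1)^2 ∧
       (z.1 - p2)^2 + (z.2.1 - q2)^2 = (z.2.2 - ρ2)^2 ∧
       (z.1 - p3)^2 + (z.2.1 - q3)^2 = (z.2.2 - ρ3)^2}

def Lin (p1 q1 p2 q2 p3 q3 ρ1 ρ2 ρ3 : ℝ) : Set (ℝ × ℝ × ℝ) :=
  {z | z.1^2 + z.2.1^2 = 1 ∧ z.1 * p1 + z.2.1 * q1 - z.2.2 = ρ1 ∧
       z.1 * p2 + z.2.1 * q2 - z.2.2 = ρ2 ∧ z.1 * p3 + z.2.1 * q3 - z.2.2 = ρ3}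

def MM (p1 q1 p2 q2 ρ1 ρ2 : ℝ) : ℝ := (p2 - p1)^2 + (q2 - q1)^2 - (ρ2 - ρ1)^2

def Good (p1 q1 p2 q2 p3 q3 ρ1 ρ2 ρ3 : ℝ) : Prop :=
  Finite (Circ p1 q1 p2 q2 p3 q3 ρ1 ρ2 ρ3) ∧ Finite (Lin p1 q1 p2 q2 p3 q3 ρ1 ρ2 ρ3) ∧
  Nat.card (Circ p1 q1 p2 q2 p3 q3 ρ1 ρ2 ρ3) + Nat.card (Lin p1 q1 p2 q2 p3 q3 ρ1 ρ2 ρ3) ≤ 2 ∧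
  (Nat.card (Circ p1 q1 p2 q2 p3 q3 ρ1 ρ2 ρ3) + Nat.card (Lin p1 q1 p2 q2 p3 q3 ρ1 ρ2 ρ3) = 1 ↔
    (MM p1 q1 p2 q2 ρ1 ρ2 = 0 ∨ MM p1 q1 p3 q3 ρ1 ρ3 = 0 ∨ MM p2 q2 p3 q3 ρ2 ρ3 = 0))

set_option maxHeartbeats 2000000 in
lemma good_core (p1 q1 p2 q2 p3 q3 ρ1 ρ2 ρ3 : ℝ) (hm : MM p1 q1 p2 q2 ρ1 ρ2 ≠ 0)
    (h13 : ¬ (p1 = p3 ∧ q1 = q3 ∧ ρ1 = ρ3)) (h23 : ¬ (p2 = p3 ∧ q2 = q3 ∧ ρ2 = ρ3)) :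
    Good p1 q1 p2 q2 p3 q3 ρ1 ρ2 ρ3 := by
  set m2 := MM p1 q1 p2 q2 ρ1 ρ2 with hm2
  set m3 := MM p1 q1 p3 q3 ρ1 ρ3 with hm3
  set w1 := m3 * (p2 - p1) - m2 * (p3 - p1) with hw1
  set w2 := m3 * (q2 - q1) - m2 * (q3 - q1) with hw2
  set ω := m3 * (ρ2 - ρ1) - m2 * (ρ3 - ρ1) with hω
  have hW : w1^2 + w2^2 - ω^2 = m2 * m3 * MM p2 q2 p3 q3 ρ2 ρ3 := by
    simp only [hw1, hw2, hω, hm2, hm3, MM]; ring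
  have hne : ¬ (w1 = 0 ∧ w2 = 0 ∧ ω = 0) := by
    rintro ⟨e1, e2, e3⟩
    have f1 : p3 - p1 = m3 / m2 * (p2 - p1) := by field_simp; linarith
    have f2 : q3 - q1 = m3 / m2 * (q2 - q1) := by field_simp; linarith
    have f3 : ρ3 - ρ1 = m3 / m2 * (ρ2 - ρ1) := by field_simp; linarith
    set l := m3 / m2 with hl
    have f4 : m3 = l * m2 := by rw [hl]; field_simp
    have f5 : m3 = l^2 * m2 := by
      rw [hm3, hm2]; unfold MM; rw [f1, f2, f3]; ring
    have f6 : l * (l - 1) = 0 := by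
      apply mul_right_cancel₀ hm
      linarith
    rcases mul_eq_zero.1 f6 with f | f
    · rw [f] at f1 f2 f3
      exact h13 ⟨by linarith, by linarith, by linarith⟩
    · have f : l = 1 := by linarith
      rw [f] at f1 f2 f3
      exact h23 ⟨by linarith, by linarith, by linarith⟩
  obtain ⟨hfin, hle, hone⟩ := EE_card w1 w2 ω hne
  -- facts about circles
  have hC : ∀ z ∈ Circ p1 q1 p2 q2 p3 q3 ρ1 ρ2 ρ3, z.2.2 - ρ1 ≠ 0 ∧
      2 * ((z.1 - p1) * (p2 - p1) + (z.2.1 - q1) * (q2 - q1) - (z.2.2 - ρ1) * (ρ2 - ρ1)) = m2 ∧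
      2 * ((z.1 - p1) * (p3 - p1) + (z.2.1 - q1) * (q3 - q1) - (z.2.2 - ρ1) * (ρ3 - ρ1)) = m3 := by
    rintro ⟨a, b, s⟩ ⟨h1, h2, h3⟩
    simp only at h1 h2 h3 ⊢
    have g2 : 2 * ((a - p1) * (p2 - p1) + (b - q1) * (q2 - q1) - (s - ρ1) * (ρ2 - ρ1)) = m2 := by
      rw [hm2]; unfold MM; linear_combination h1 - h2
    refine ⟨?_, g2, ?_⟩
    · intro h0
      rw [h0] at h1
      have ha : a - p1 = 0 := sq_zero_left _ _ h1
      have hb : b - q1 = 0 := sq_zero_left _ _ ((add_comm _ _).trans h1)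
      apply hm
      rw [← g2, h0, ha, hb]; ring
    · rw [hm3]; unfold MM; linear_combination h1 - h3
  let f : Circ p1 q1 p2 q2 p3 q3 ρ1 ρ2 ρ3 ⊕ Lin p1 q1 p2 q2 p3 q3 ρ1 ρ2 ρ3 → EE w1 w2 ω :=
    Sum.elim
      (fun z => ⟨((z.1.1 - p1) / (z.1.2.2 - ρ1), (z.1.2.1 - q1) / (z.1.2.2 - ρ1)), by
        obtain ⟨g1, g2, g3⟩ := hC z.1 z.2
        obtain ⟨⟨a, b, s⟩, h1, h2, h3⟩ := z
        simp only at g1 g2 g3 h1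
        constructor
        · simp only
          rw [div_pow, div_pow, ← add_div, div_eq_one_iff_eq (by positivity)]
          exact h1
        · simp only
          field_simp
          rw [hw1, hw2, hω]
          linear_combination (1/2) * m3 * g2 - (1/2) * m2 * g3⟩)
      (fun z => ⟨(z.1.1, z.1.2.1), by
        obtain ⟨⟨a, b, s⟩, h1, h2, h3, h4⟩ := z
        simp only at h1 h2 h3 h4
        refine ⟨h1, ?_⟩
        simp only
        rw [hw1, hw2, hω]
        linear_combination m3 * (h3 - h2) - m2 * (h4 - h2)⟩)
  have hf : Function.Bijective f := by
    constructor
    · rintro (z | z) (z' | z') h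
      · congr 1
        obtain ⟨g1, g2, g3⟩ := hC z.1 z.2
        obtain ⟨g1', g2', g3'⟩ := hC z'.1 z'.2
        obtain ⟨⟨a, b, s⟩, hz⟩ := z
        obtain ⟨⟨a', b', s'⟩, hz'⟩ := z'
        simp only [f, Sum.elim_inl, Subtype.mk.injEq, Prod.mk.injEq] at h g1 g1' g2 g2' ⊢
        obtain ⟨e1, e2⟩ := h
        rw [div_eq_iff g1] at e1 e2
        set n1 := (a' - p1) / (s' - ρ1) with hn1
        set n2 := (b' - q1) / (s' - ρ1) with hn2
        have e1' : a' - p1 = n1 * (s' - ρ1) := by rw [hn1]; field_simp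
        have e2' : b' - q1 = n2 * (s' - ρ1) := by rw [hn2]; field_simp
        rw [e1, e2] at g2
        rw [e1', e2'] at g2'
        have hee : (s - ρ1) * (2 * (n1 * (p2 - p1) + n2 * (q2 - q1) - (ρ2 - ρ1))) = m2 := by
          rw [← g2]; ring
        have hee' : (s' - ρ1) * (2 * (n1 * (p2 - p1) + n2 * (q2 - q1) - (ρ2 - ρ1))) = m2 := by
          rw [← g2']; ring
        have hne : (2 * (n1 * (p2 - p1) + n2 * (q2 - q1) - (ρ2 - ρ1))) ≠ 0 := by
          intro h0; rw [h0] at hee; apply hm; linarith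
        have hs : s - ρ1 = s' - ρ1 := mul_right_cancel₀ hne (hee.trans hee'.symm)
        rw [hs] at e1 e2
        exact ⟨by linarith, by linarith, by linarith⟩
      · exfalso
        obtain ⟨g1, g2, g3⟩ := hC z.1 z.2
        obtain ⟨⟨a, b, s⟩, hz⟩ := z
        obtain ⟨⟨a', b', s'⟩, h1, h2, h3, h4⟩ := z'
        simp only [f, Sum.elim_inl, Sum.elim_inr, Subtype.mk.injEq, Prod.mk.injEq] at h g1 g2 h1 h2 h3 h4
        obtain ⟨e1, e2⟩ := h
        rw [div_eq_iff g1] at e1 e2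
        apply hm
        rw [← g2, e1, e2]
        linear_combination 2 * (s - ρ1) * (h3 - h2)
      · exfalso
        obtain ⟨g1, g2, g3⟩ := hC z'.1 z'.2
        obtain ⟨⟨a, b, s⟩, hz⟩ := z'
        obtain ⟨⟨a', b', s'⟩, h1, h2, h3, h4⟩ := z
        simp only [f, Sum.elim_inl, Sum.elim_inr, Subtype.mk.injEq, Prod.mk.injEq] at h g1 g2 h1 h2 h3 h4
        obtain ⟨e1, e2⟩ := h
        rw [eq_div_iff g1] at e1 e2
        apply hm
        rw [← g2, ← e1, ← e2]
        linear_combination 2 * (s - ρ1) * (h3 - h2)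
      · congr 1
        obtain ⟨⟨a, b, s⟩, h1, h2, h3, h4⟩ := z
        obtain ⟨⟨a', b', s'⟩, h1', h2', h3', h4'⟩ := z'
        simp only [f, Sum.elim_inr, Subtype.mk.injEq, Prod.mk.injEq] at h h2 h2' ⊢
        obtain ⟨rfl, rfl⟩ := h
        have : s = s' := by linarith
        subst this
        rfl
    · rintro ⟨⟨a, b⟩, h1, h2⟩
      simp only at h1 h2
      set e2 := 2 * (a * (p2 - p1) + b * (q2 - q1) - (ρ2 - ρ1)) with he2
      set e3 := 2 * (a * (p3 - p1) + b * (q3 - q1) - (ρ3 - ρ1)) with he3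
      have hee : m3 * e2 = m2 * e3 := by
        rw [he2, he3]; rw [hw1, hw2, hω] at h2; linear_combination 2 * h2
      by_cases h0 : e2 = 0
      · have h0' : e3 = 0 := by
          rw [h0] at hee
          have : m2 * e3 = 0 := by linarith
          exact (mul_eq_zero.1 this).resolve_left hm
        refine ⟨Sum.inr ⟨(a, b, a * p1 + b * q1 - ρ1), ⟨h1, by simp only; ring, ?_, ?_⟩⟩, rfl⟩
        · simp only; linarith
        · simp only; linarith
      · have hσ : m2 / e2 ≠ 0 := div_ne_zero hm h0
        have k2 : m2 / e2 * e2 = m2 := by field_simp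
        have k3 : m2 / e2 * e3 = m3 := by field_simp; linarith
        set σ := m2 / e2 with hsig
        refine ⟨Sum.inl ⟨(p1 + σ * a, q1 + σ * b, ρ1 + σ), ⟨?_, ?_, ?_⟩⟩, ?_⟩
        · simp only; linear_combination σ^2 * h1
        · simp only
          rw [he2, hm2] at k2; unfold MM at k2
          linear_combination σ^2 * h1 - k2
        · simp only
          rw [he3, hm3] at k3; unfold MM at k3
          linear_combination σ^2 * h1 - k3
        · apply Subtype.ext
          simp only [f, Sum.elim_inl, Prod.mk.injEq]
          constructor <;> (rw [add_sub_cancel_left, add_sub_cancel_left]; field_simp)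
  have e := Equiv.ofBijective f hf
  have hfinE : Finite (EE w1 w2 ω) := hfin
  have hfS := Finite.of_equiv _ e.symm
  have hf1 : Finite (Circ p1 q1 p2 q2 p3 q3 ρ1 ρ2 ρ3) :=
    Finite.of_injective (fun z => (Sum.inl z : Circ p1 q1 p2 q2 p3 q3 ρ1 ρ2 ρ3 ⊕ Lin p1 q1 p2 q2 p3 q3 ρ1 ρ2 ρ3)) Sum.inl_injective
  have hf2 : Finite (Lin p1 q1 p2 q2 p3 q3 ρ1 ρ2 ρ3) :=
    Finite.of_injective (fun z => (Sum.inr z : Circ p1 q1 p2 q2 p3 q3 ρ1 ρ2 ρ3 ⊕ Lin p1 q1 p2 q2 p3 q3 ρ1 ρ2 ρ3)) Sum.inr_injective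
  have hc : Nat.card (Circ p1 q1 p2 q2 p3 q3 ρ1 ρ2 ρ3) + Nat.card (Lin p1 q1 p2 q2 p3 q3 ρ1 ρ2 ρ3)
      = (EE w1 w2 ω).ncard := by
    rw [← Nat.card_sum, Nat.card_congr e]; rfl
  refine ⟨hf1, hf2, by rw [hc]; exact hle, ?_⟩
  rw [hc, hone, hW]
  simp only [← hm2, ← hm3, mul_eq_zero]
  exact or_assoc

lemma MM_symm (p1 q1 p2 q2 ρ1 ρ2 : ℝ) : MM p1 q1 p2 q2 ρ1 ρ2 = MM p2 q2 p1 q1 ρ2 ρ1 := by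
  unfold MM; ring

set_option maxHeartbeats 2000000 in
lemma good_all (p1 q1 p2 q2 p3 q3 ρ1 ρ2 ρ3 : ℝ)
    (h12 : ¬ (p1 = p2 ∧ q1 = q2 ∧ ρ1 = ρ2))
    (h13 : ¬ (p1 = p3 ∧ q1 = q3 ∧ ρ1 = ρ3)) (h23 : ¬ (p2 = p3 ∧ q2 = q3 ∧ ρ2 = ρ3))
    (hm : ¬ (MM p1 q1 p2 q2 ρ1 ρ2 = 0 ∧ MM p1 q1 p3 q3 ρ1 ρ3 = 0 ∧ MM p2 q2 p3 q3 ρ2 ρ3 = 0)) :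
    Good p1 q1 p2 q2 p3 q3 ρ1 ρ2 ρ3 := by
  by_cases m12 : MM p1 q1 p2 q2 ρ1 ρ2 = 0
  · by_cases m13 : MM p1 q1 p3 q3 ρ1 ρ3 = 0
    · have m23 : MM p2 q2 p3 q3 ρ2 ρ3 ≠ 0 := fun h => hm ⟨m12, m13, h⟩
      have := good_core p2 q2 p3 q3 p1 q1 ρ2 ρ3 ρ1 m23 (by grind) (by grind)
      have eC : Circ p2 q2 p3 q3 p1 q1 ρ2 ρ3 ρ1 = Circ p1 q1 p2 q2 p3 q3 ρ1 ρ2 ρ3 := by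
        ext z; clear hm h12 h13 h23 this; simp only [Circ, Set.mem_ofPred_eq]; tauto
      have eL : Lin p2 q2 p3 q3 p1 q1 ρ2 ρ3 ρ1 = Lin p1 q1 p2 q2 p3 q3 ρ1 ρ2 ρ3 := by
        ext z; clear hm h12 h13 h23 this; simp only [Lin, Set.mem_ofPred_eq]; tauto
      unfold Good at *
      rw [eC, eL, MM_symm p2 q2 p1 q1, MM_symm p3 q3 p1 q1] at this
      obtain ⟨a, b, c, d⟩ := this
      refine ⟨a, b, c, d.trans ?_⟩
      clear a b c d eC eL hm h12 h13 h23
      tauto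
    · have := good_core p1 q1 p3 q3 p2 q2 ρ1 ρ3 ρ2 m13 (by grind) (by grind)
      have eC : Circ p1 q1 p3 q3 p2 q2 ρ1 ρ3 ρ2 = Circ p1 q1 p2 q2 p3 q3 ρ1 ρ2 ρ3 := by
        ext z; clear hm h12 h13 h23 this; simp only [Circ, Set.mem_ofPred_eq]; tauto
      have eL : Lin p1 q1 p3 q3 p2 q2 ρ1 ρ3 ρ2 = Lin p1 q1 p2 q2 p3 q3 ρ1 ρ2 ρ3 := by
        ext z; clear hm h12 h13 h23 this; simp only [Lin, Set.mem_ofPred_eq]; tauto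
      unfold Good at *
      rw [eC, eL, MM_symm p3 q3 p2 q2] at this
      obtain ⟨a, b, c, d⟩ := this
      refine ⟨a, b, c, d.trans ?_⟩
      clear a b c d eC eL hm h12 h13 h23
      tauto
  · exact good_core _ _ _ _ _ _ _ _ _ m12 h13 h23

def sg (b : Bool) : ℝ := if b then 1 else -1

lemma dist_sq_pl (y x : Pl) : dist y x ^ 2 = (y 0 - x 0)^2 + (y 1 - x 1)^2 := by
  rw [EuclideanSpace.dist_eq, Real.sq_sqrt (by positivity), Fin.sum_univ_two, Real.dist_eq,
    Real.dist_eq, sq_abs, sq_abs]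

lemma mem_K_iff (p x : Pl) (r : ℝ) (hr : 0 < r) :
    p ∈ K x r ↔ (p 0 - x 0)^2 + (p 1 - x 1)^2 = r^2 := by
  rw [← dist_sq_pl, sq_eq_sq₀ dist_nonneg hr.le]
  rfl

lemma tangent_iff (y x : Pl) (s r : ℝ) (hs : 0 < s) (hr : 0 < r) :
    CircleTangent y s x r ↔
      ((y 0 - x 0)^2 + (y 1 - x 1)^2 = (s - r)^2 ∨ (y 0 - x 0)^2 + (y 1 - x 1)^2 = (s + r)^2) := by
  have h1 : dist y x ^ 2 = (s + r)^2 ↔ dist y x = s + r := sq_eq_sq₀ dist_nonneg (by positivity)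
  rw [← dist_sq_pl, h1, ← sq_abs (s - r), sq_eq_sq₀ dist_nonneg (abs_nonneg _), or_comm]
  rfl

lemma sg_tangent (D s r : ℝ) (b : Bool) (h : D = (s - sg b * r)^2) :
    D = (|s| - r)^2 ∨ D = (|s| + r)^2 := by
  rcases abs_choice s with h1 | h1 <;> rw [h1, h] <;> cases b <;> simp only [sg, if_true] <;>
    [right; left; left; right] <;> simp <;> ring

lemma sg_exists (D s r : ℝ) (h : D = (|s| - r)^2 ∨ D = (|s| + r)^2) :
    ∃ b, D = (s - sg b * r)^2 := by
  rcases abs_choice s with h1 | h1 <;> rw [h1] at h <;> rcases h with h | h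
  · exact ⟨true, by rw [h]; simp [sg]⟩
  · exact ⟨false, by rw [h]; simp [sg]⟩
  · exact ⟨false, by rw [h]; simp [sg]; ring⟩
  · exact ⟨true, by rw [h]; simp [sg]; ring⟩

lemma sg_inj (s r : ℝ) (hs : s ≠ 0) (hr : 0 < r) (b b' : Bool)
    (h : (s - sg b * r)^2 = (s - sg b' * r)^2) : b = b' := by
  have : s * r ≠ 0 := mul_ne_zero hs hr.ne'
  cases b <;> cases b' <;> simp [sg] at h ⊢ <;> (apply this; linarith)

lemma sg_inj' (r : ℝ) (hr : 0 < r) (b b' : Bool)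
    (h : sg b * r = sg b' * r) : b = b' := by
  cases b <;> cases b' <;> simp [sg] at h ⊢ <;> linarith

lemma sg_sq (r : ℝ) (b : Bool) : (0 - sg b * r)^2 = r^2 := by
  cases b <;> simp [sg]

lemma sg_abs (t r : ℝ) (hr : 0 < r) : |t| = r ↔ ∃ b, t = sg b * r := by
  rw [abs_eq hr.le]
  constructor
  · rintro (h | h)
    · exact ⟨true, by simp [sg, h]⟩
    · exact ⟨false, by simp [sg, h]⟩
  · rintro ⟨b, h⟩
    cases b <;> simp [sg] at h <;> simp [h]

def CC (x₁ x₂ x₃ : Pl) (r₁ r₂ r₃ : ℝ) (c : Bool × Bool) : Set (ℝ × ℝ × ℝ) :=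
  Circ (x₁ 0) (x₁ 1) (x₂ 0) (x₂ 1) (x₃ 0) (x₃ 1) r₁ (sg c.1 * r₂) (sg c.2 * r₃)

def LL (x₁ x₂ x₃ : Pl) (r₁ r₂ r₃ : ℝ) (c : Bool × Bool) : Set (ℝ × ℝ × ℝ) :=
  Lin (x₁ 0) (x₁ 1) (x₂ 0) (x₂ 1) (x₃ 0) (x₃ 1) r₁ (sg c.1 * r₂) (sg c.2 * r₃)

abbrev Z0 : Set (ℝ × ℝ × ℝ) := {z | z.2.2 = 0}

lemma pl_ext (p : Pl) (a b : ℝ) (h0 : p 0 = a) (h1 : p 1 = b) : !₂[a, b] = p := by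
  ext i; fin_cases i <;> simp [h0, h1]

lemma circles_equiv (x₁ x₂ x₃ : Pl) (r₁ r₂ r₃ : ℝ)
    (h₁ : 0 < r₁) (h₂ : 0 < r₂) (h₃ : 0 < r₃) :
    Nonempty ((Σ c, ↥(CC x₁ x₂ x₃ r₁ r₂ r₃ c \ Z0)) ≃
      {ys : Pl × ℝ // 0 < ys.2 ∧ ∀ i, CircleTangent ys.1 ys.2 (![x₁, x₂, x₃] i) (![r₁, r₂, r₃] i)}) := by
  refine ⟨Equiv.ofBijective (fun z => ⟨(!₂[z.2.1.1, z.2.1.2.1], |z.2.1.2.2|), ?_⟩) ⟨?_, ?_⟩⟩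
  · obtain ⟨c, ⟨a, b, s⟩, ⟨g1, g2, g3⟩, hs⟩ := z
    have hs : 0 < |s| := abs_pos.2 hs
    refine ⟨hs, ?_⟩
    simp only at g1 g2 g3 hs ⊢
    rw [Fin.forall_fin_succ, Fin.forall_fin_two]
    refine ⟨(tangent_iff _ _ _ _ hs h₁).2 (sg_tangent _ _ _ true ?_),
      (tangent_iff _ _ _ _ hs h₂).2 (sg_tangent _ _ _ c.1 g2),
      (tangent_iff _ _ _ _ hs h₃).2 (sg_tangent _ _ _ c.2 g3)⟩
    simp [sg]
    exact g1
  · rintro ⟨⟨c, d⟩, ⟨a, b, s⟩, ⟨g1, g2, g3⟩, hs⟩ ⟨⟨c', d'⟩, ⟨a', b', s'⟩, ⟨g1', g2', g3'⟩, hs'⟩ h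
    simp only [Subtype.mk.injEq, Prod.mk.injEq] at h
    obtain ⟨h, h'⟩ := h
    have e0 := congrArg (fun p : Pl => p 0) h
    have e1 := congrArg (fun p : Pl => p 1) h
    simp at e0 e1
    subst e0 e1
    simp only at g1 g2 g3 g1' g2' g3'
    have hs0 : s ≠ 0 := hs
    have e : s = s' := by
      rcases abs_eq_abs.1 h' with h' | h'
      · exact h'
      · exfalso
        rw [h', g1'] at g1
        have : s' * r₁ = 0 := by linarith
        rcases mul_eq_zero.1 this with h | h
        · exact hs' h
        · exact h₁.ne' h
    subst e
    have ec := sg_inj s r₂ hs0 h₂ c c' (g2.symm.trans g2')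
    have ed := sg_inj s r₃ hs0 h₃ d d' (g3.symm.trans g3')
    subst ec ed
    rfl
  · rintro ⟨⟨y, s⟩, hs, ht⟩
    rw [Fin.forall_fin_succ, Fin.forall_fin_two] at ht
    obtain ⟨t1, t2, t3⟩ := ht
    simp only at hs
    have t1 := (tangent_iff _ _ _ _ hs h₁).1 t1
    have t2 := (tangent_iff _ _ _ _ hs h₂).1 t2
    have t3 := (tangent_iff _ _ _ _ hs h₃).1 t3
    obtain ⟨s', hs', u1⟩ : ∃ s', |s'| = s ∧ (y 0 - x₁ 0)^2 + (y 1 - x₁ 1)^2 = (s' - r₁)^2 := by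
      rcases t1 with t1 | t1
      · exact ⟨s, abs_of_pos hs, t1⟩
      · exact ⟨-s, by rw [abs_neg, abs_of_pos hs], t1.trans (by ring)⟩
    rw [← hs'] at t2 t3
    obtain ⟨c, u2⟩ := sg_exists _ _ _ t2
    obtain ⟨d, u3⟩ := sg_exists _ _ _ t3
    refine ⟨⟨(c, d), ⟨(y 0, y 1, s'), ⟨u1, u2, u3⟩, ?_⟩⟩, ?_⟩
    · intro h0
      have h0 : s' = 0 := h0
      rw [h0, abs_zero] at hs'
      linarith
    · apply Subtype.ext
      simp only
      rw [pl_ext y _ _ rfl rfl, hs']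

lemma points_equiv (x₁ x₂ x₃ : Pl) (r₁ r₂ r₃ : ℝ)
    (h₁ : 0 < r₁) (h₂ : 0 < r₂) (h₃ : 0 < r₃) (c : Bool × Bool) :
    Nonempty (↥(CC x₁ x₂ x₃ r₁ r₂ r₃ c ∩ Z0) ≃
      {p : Pl // ∀ i, p ∈ K (![x₁, x₂, x₃] i) (![r₁, r₂, r₃] i)}) := by
  refine ⟨Equiv.ofBijective (fun z => ⟨!₂[z.1.1, z.1.2.1], ?_⟩) ⟨?_, ?_⟩⟩
  · obtain ⟨⟨a, b, s⟩, ⟨g1, g2, g3⟩, hs⟩ := z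
    have hs : s = 0 := hs
    subst hs
    rw [Fin.forall_fin_succ, Fin.forall_fin_two]
    simp only at g1 g2 g3
    rw [sg_sq] at g2 g3
    refine ⟨(mem_K_iff _ _ _ h₁).2 (g1.trans (by ring)), (mem_K_iff _ _ _ h₂).2 g2,
      (mem_K_iff _ _ _ h₃).2 g3⟩
  · rintro ⟨⟨a, b, s⟩, hz, hs⟩ ⟨⟨a', b', s'⟩, hz', hs'⟩ h
    have hs : s = 0 := hs
    have hs' : s' = 0 := hs'
    subst hs hs'
    simp only [Subtype.mk.injEq] at h
    have e0 := congrArg (fun p : Pl => p 0) h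
    have e1 := congrArg (fun p : Pl => p 1) h
    simp at e0 e1
    subst e0 e1
    rfl
  · rintro ⟨y, ht⟩
    rw [Fin.forall_fin_succ, Fin.forall_fin_two] at ht
    obtain ⟨t1, t2, t3⟩ := ht
    have t1 := (mem_K_iff _ _ _ h₁).1 t1
    have t2 := (mem_K_iff _ _ _ h₂).1 t2
    have t3 := (mem_K_iff _ _ _ h₃).1 t3
    refine ⟨⟨(y 0, y 1, 0), ⟨t1.trans (by ring), t2.trans (sg_sq _ _).symm, t3.trans (sg_sq _ _).symm⟩, rfl⟩, ?_⟩
    apply Subtype.ext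
    exact pl_ext y _ _ rfl rfl

def lineOf (a b h : ℝ) : AffineSubspace ℝ Pl :=
  AffineSubspace.mk' !₂[a * h, b * h] (Submodule.span ℝ {!₂[-b, a]})

lemma mem_lineOf (a b h : ℝ) (hab : a^2 + b^2 = 1) (q : Pl) :
    q ∈ lineOf a b h ↔ a * q 0 + b * q 1 = h := by
  rw [lineOf, AffineSubspace.mem_mk', Submodule.mem_span_singleton]
  constructor
  · rintro ⟨t, ht⟩
    have e0 := congrArg (fun p : Pl => p 0) ht
    have e1 := congrArg (fun p : Pl => p 1) ht
    simp at e0 e1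
    linear_combination -a * e0 - b * e1 + h * hab
  · intro hq
    refine ⟨a * q 1 - b * q 0, ?_⟩
    ext i; fin_cases i
    · simp
      linear_combination q 0 * hab - a * hq
    · simp
      linear_combination q 1 * hab - b * hq

lemma lineOf_tangent (a b h : ℝ) (hab : a^2 + b^2 = 1) (x : Pl) (r : ℝ) (hr : 0 < r) :
    LineTangent (lineOf a b h) x r ↔ |a * x 0 + b * x 1 - h| = r := by
  have key : ∀ q, q ∈ ((lineOf a b h : AffineSubspace ℝ Pl) : Set Pl) ∩ K x r ↔
      a * q 0 + b * q 1 = h ∧ (q 0 - x 0)^2 + (q 1 - x 1)^2 = r^2 := by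
    intro q
    rw [Set.mem_inter_iff, mem_K_iff _ _ _ hr, SetLike.mem_coe, mem_lineOf _ _ _ hab]
  unfold LineTangent
  simp only [key]
  set e := a * x 0 + b * x 1 - h with he
  constructor
  · rintro ⟨q, ⟨h1, h2⟩, h3⟩
    -- the reflected point
    have := h3 !₂[2 * (x 0 - e * a) - q 0, 2 * (x 1 - e * b) - q 1] ⟨by
      simp
      linear_combination -h1 - 2 * e * hab + 2 * he, by
      simp
      linear_combination h2 + 4 * e * (h1 + he) + 4 * e^2 * hab⟩
    have e0 := congrArg (fun p : Pl => p 0) this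
    have e1 := congrArg (fun p : Pl => p 1) this
    simp at e0 e1
    have f0 : q 0 = x 0 - e * a := by linarith
    have f1 : q 1 = x 1 - e * b := by linarith
    rw [f0, f1] at h2
    have : e^2 = r^2 := by linear_combination h2 - e^2 * hab
    rwa [← sq_abs, sq_eq_sq₀ (abs_nonneg _) hr.le] at this
  · intro hh
    have h2 : e^2 = r^2 := by rw [← sq_abs, hh]
    refine ⟨!₂[x 0 - e * a, x 1 - e * b], ⟨?_, ?_⟩, ?_⟩
    · simp
      linear_combination he - e * hab
    · simp
      linear_combination h2 + e^2 * hab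
    · rintro q ⟨g1, g2⟩
      have : (q 0 - x 0 + e * a)^2 + (q 1 - x 1 + e * b)^2 = 0 ^ 2 := by
        linear_combination g2 - h2 + e^2 * hab + 2 * e * (g1 + he)
      have f0 := sq_zero_left _ _ this
      have f1 := sq_zero_left _ _ ((add_comm _ _).trans this)
      exact (pl_ext q _ _ (by linarith) (by linarith)).symm

lemma lineOf_finrank (a b h : ℝ) (hab : a^2 + b^2 = 1) :
    Module.finrank ℝ (lineOf a b h).direction = 1 := by
  rw [lineOf, AffineSubspace.direction_mk']
  apply finrank_span_singleton
  intro h0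
  have e0 := congrArg (fun p : Pl => p 0) h0
  have e1 := congrArg (fun p : Pl => p 1) h0
  simp at e0 e1
  rw [e0, e1] at hab
  norm_num at hab

lemma exists_lineOf (L : AffineSubspace ℝ Pl) (hL : Module.finrank ℝ L.direction = 1)
    (p : Pl) (hp : p ∈ L) : ∃ a b h, a^2 + b^2 = 1 ∧ L = lineOf a b h := by
  obtain ⟨⟨v, hv⟩, hv0, hspan⟩ := finrank_eq_one_iff'.1 hL
  have hv0 : v ≠ 0 := fun h => hv0 (Subtype.ext h)
  set N := v 0 ^2 + v 1 ^2 with hN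
  have hNpos : 0 < N := by
    have : N ≠ 0 := by
      intro h0
      have h0 : v 0 ^2 + v 1 ^2 = 0 ^ 2 := by rw [← hN, h0]; ring
      have f0 := sq_zero_left _ _ h0
      have f1 := sq_zero_left _ _ ((add_comm _ _).trans h0)
      apply hv0
      ext i; fin_cases i
      · simpa using f0
      · simpa using f1
    have : 0 ≤ N := by positivity
    exact lt_of_le_of_ne this (Ne.symm ‹N ≠ 0›)
  have hsq : Real.sqrt N ^ 2 = N := Real.sq_sqrt hNpos.le
  set k := Real.sqrt N with hk
  have hk0 : k ≠ 0 := by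
    intro h; rw [h] at hsq; linarith
  have hab : (v 1 / k)^2 + (-v 0 / k)^2 = 1 := by
    field_simp
    rw [hsq, hN]; ring
  refine ⟨v 1 / k, -v 0 / k, v 1 / k * p 0 + -v 0 / k * p 1, hab, ?_⟩
  ext q
  rw [mem_lineOf _ _ _ hab]
  have hq : q ∈ L ↔ q -ᵥ p ∈ L.direction := (AffineSubspace.vsub_right_mem_direction_iff_mem hp q).symm
  rw [hq]
  constructor
  · intro hq
    obtain ⟨c, hc⟩ := hspan ⟨_, hq⟩
    have hc := congrArg Subtype.val hc
    simp only [SetLike.mk_smul_mk] at hc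
    have e0 := congrArg (fun p : Pl => p 0) hc
    have e1 := congrArg (fun p : Pl => p 1) hc
    simp at e0 e1
    field_simp
    linear_combination -v 1 * e0 + v 0 * e1
  · intro hq
    have hq : v 1 * (q 0 - p 0) = v 0 * (q 1 - p 1) := by
      field_simp at hq
      linarith
    have : q -ᵥ p = ((v 0 * (q 0 - p 0) + v 1 * (q 1 - p 1)) / N) • v := by
      ext i; fin_cases i
      · simp
        field_simp
        rw [hN]
        linear_combination v 1 * hq
      · simp
        field_simp
        rw [hN]
        linear_combination - v 0 * hq
    rw [this]
    exact Submodule.smul_mem _ _ hv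

lemma lines_equiv (x₁ x₂ x₃ : Pl) (r₁ r₂ r₃ : ℝ)
    (h₁ : 0 < r₁) (h₂ : 0 < r₂) (h₃ : 0 < r₃) :
    Nonempty ((Σ c, ↥(LL x₁ x₂ x₃ r₁ r₂ r₃ c)) ≃
      {L : AffineSubspace ℝ Pl // Module.finrank ℝ L.direction = 1 ∧
        ∀ i, LineTangent L (![x₁, x₂, x₃] i) (![r₁, r₂, r₃] i)}) := by
  refine ⟨Equiv.ofBijective (fun z => ⟨lineOf z.2.1.1 z.2.1.2.1 z.2.1.2.2, ?_⟩) ⟨?_, ?_⟩⟩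
  · obtain ⟨c, ⟨a, b, h⟩, g0, g1, g2, g3⟩ := z
    simp only at g0 g1 g2 g3 ⊢
    refine ⟨lineOf_finrank _ _ _ g0, ?_⟩
    rw [Fin.forall_fin_succ, Fin.forall_fin_two]
    refine ⟨(lineOf_tangent _ _ _ g0 _ _ h₁).2 ?_, (lineOf_tangent _ _ _ g0 _ _ h₂).2 ?_,
      (lineOf_tangent _ _ _ g0 _ _ h₃).2 ?_⟩
    · exact (sg_abs _ _ h₁).2 ⟨true, g1.trans (by simp [sg])⟩
    · exact (sg_abs _ _ h₂).2 ⟨_, g2⟩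
    · exact (sg_abs _ _ h₃).2 ⟨_, g3⟩
  · rintro ⟨⟨c, d⟩, ⟨a, b, h⟩, g0, g1, g2, g3⟩ ⟨⟨c', d'⟩, ⟨a', b', h'⟩, g0', g1', g2', g3'⟩ hh
    simp only [Subtype.mk.injEq] at hh
    simp only at g0 g1 g2 g3 g0' g1' g2' g3'
    have hp : !₂[a * h, b * h] ∈ lineOf a' b' h' := by
      rw [← hh, mem_lineOf _ _ _ g0]; simp; linear_combination h * g0
    have hp2 : !₂[a * h - b, b * h + a] ∈ lineOf a' b' h' := by
      rw [← hh, mem_lineOf _ _ _ g0]; simp; linear_combination h * g0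
    rw [mem_lineOf _ _ _ g0'] at hp hp2
    simp at hp hp2
    have k1 : a' * b = b' * a := by linarith
    -- μ = a a' + b b'
    obtain ⟨μ, ha, hb⟩ : ∃ μ, a' = μ * a ∧ b' = μ * b := by
      refine ⟨a * a' + b * b', ?_, ?_⟩
      · linear_combination -a' * g0 + b * k1
      · linear_combination -b' * g0 - a * k1
    have hh' : h' = μ * h := by
      rw [← hp, ha, hb]; linear_combination μ * h * g0
    have hμ : μ = 1 := by
      have : μ * r₁ = r₁ := by
        nth_rewrite 2 [← g1']
        rw [← g1, ha, hb, hh']; ring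
      exact mul_right_cancel₀ h₁.ne' (this.trans (one_mul _).symm)
    rw [hμ, one_mul] at ha hb hh'
    subst ha hb hh'
    have ec := sg_inj' r₂ h₂ c c' (g2.symm.trans g2')
    have ed := sg_inj' r₃ h₃ d d' (g3.symm.trans g3')
    subst ec ed
    rfl
  · rintro ⟨L, hL, ht⟩
    rw [Fin.forall_fin_succ, Fin.forall_fin_two] at ht
    obtain ⟨t1, t2, t3⟩ := ht
    obtain ⟨p, ⟨hp, _⟩, _⟩ := id t1
    obtain ⟨a, b, h, hab, rfl⟩ := exists_lineOf L hL p hp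
    have t1 := (lineOf_tangent _ _ _ hab _ _ h₁).1 t1
    obtain ⟨a', b', h', hab', hl, t1⟩ : ∃ a' b' h' : ℝ, a'^2 + b'^2 = 1 ∧
        lineOf a' b' h' = lineOf a b h ∧ a' * x₁ 0 + b' * x₁ 1 - h' = r₁ := by
      rcases (abs_eq h₁.le).1 t1 with t | t
      · exact ⟨a, b, h, hab, rfl, t⟩
      · have hn : (-a)^2 + (-b)^2 = 1 := by rw [← hab]; ring
        refine ⟨-a, -b, -h, hn, ?_, ?_⟩
        · ext q
          rw [mem_lineOf _ _ _ hab, mem_lineOf _ _ _ hn]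
          constructor <;> intro h <;> linarith
        · simp at t; linarith
    rw [← hl] at t2 t3
    have t2 := (lineOf_tangent _ _ _ hab' _ _ h₂).1 t2
    have t3 := (lineOf_tangent _ _ _ hab' _ _ h₃).1 t3
    obtain ⟨c, u2⟩ := (sg_abs _ _ h₂).1 t2
    obtain ⟨d, u3⟩ := (sg_abs _ _ h₃).1 t3
    refine ⟨⟨(c, d), ⟨(a', b', h'), hab', t1, u2, u3⟩⟩, ?_⟩
    apply Subtype.ext
    exact hl

lemma touch_unique (p0 p1 n0 n1 ρ σ r s : ℝ) (x y : Pl) (hr : 0 < r) (hs : 0 < s)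
    (hn : n0^2 + n1^2 = 1) (hx0 : x 0 = p0 + ρ * n0) (hx1 : x 1 = p1 + ρ * n1)
    (hy0 : y 0 = p0 + σ * n0) (hy1 : y 1 = p1 + σ * n1) (hρ : ρ^2 = r^2) (hσ : σ^2 = s^2)
    (hne : ρ ≠ σ) : ∃! q, q ∈ K x r ∩ K y s := by
  refine ⟨!₂[p0, p1], ⟨(mem_K_iff _ _ _ hr).2 ?_, (mem_K_iff _ _ _ hs).2 ?_⟩, ?_⟩
  · simp [hx0, hx1]; rw [← hρ]; linear_combination ρ^2 * hn
  · simp [hy0, hy1]; rw [← hσ]; linear_combination σ^2 * hn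
  · rintro q ⟨h1, h2⟩
    rw [mem_K_iff _ _ _ hr, hx0, hx1, ← hρ] at h1
    rw [mem_K_iff _ _ _ hs, hy0, hy1, ← hσ] at h2
    have h3 : (ρ - σ) * ((q 0 - p0) * n0 + (q 1 - p1) * n1) = 0 := by
      linear_combination (1/2) * (h2 - h1) + (1/2) * (ρ^2 - σ^2) * hn
    have h4 := (mul_eq_zero.1 h3).resolve_left (sub_ne_zero.2 hne)
    have h5 : (q 0 - p0)^2 + (q 1 - p1)^2 = 0^2 := by
      linear_combination h1 + 2 * ρ * h4 - ρ^2 * hn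
    have f0 := sq_zero_left _ _ h5
    have f1 := sq_zero_left _ _ ((add_comm _ _).trans h5)
    exact (pl_ext q _ _ (by linarith) (by linarith)).symm

lemma MM_rho_ne (p1 q1 p2 q2 ρ1 ρ2 : ℝ) (h12 : ¬ (p1 = p2 ∧ q1 = q2 ∧ ρ1 = ρ2))
    (m : MM p1 q1 p2 q2 ρ1 ρ2 = 0) : ρ1 ≠ ρ2 := by
  rintro rfl
  have h : (p2 - p1)^2 + (q2 - q1)^2 = 0^2 := by unfold MM at m; linarith
  have f0 := sq_zero_left _ _ h
  have f1 := sq_zero_left _ _ ((add_comm _ _).trans h)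
  exact h12 ⟨by linarith, by linarith, rfl⟩

lemma not_all_zero (x₁ x₂ x₃ : Pl) (r₁ r₂ r₃ : ℝ)
    (h₁ : 0 < r₁) (h₂ : 0 < r₂) (h₃ : 0 < r₃) (ρ1 ρ2 ρ3 : ℝ)
    (hρ1 : ρ1^2 = r₁^2) (hρ2 : ρ2^2 = r₂^2) (hρ3 : ρ3^2 = r₃^2)
    (h12 : ¬ (x₁ 0 = x₂ 0 ∧ x₁ 1 = x₂ 1 ∧ ρ1 = ρ2))
    (h13 : ¬ (x₁ 0 = x₃ 0 ∧ x₁ 1 = x₃ 1 ∧ ρ1 = ρ3))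
    (h23 : ¬ (x₂ 0 = x₃ 0 ∧ x₂ 1 = x₃ 1 ∧ ρ2 = ρ3))
    (hnd : ¬ ∃ p : Pl, p ∈ K x₁ r₁ ∩ K x₂ r₂ ∩ K x₃ r₃ ∧
      (∃! q, q ∈ K x₁ r₁ ∩ K x₂ r₂) ∧ (∃! q, q ∈ K x₁ r₁ ∩ K x₃ r₃) ∧
      (∃! q, q ∈ K x₂ r₂ ∩ K x₃ r₃)) :
    ¬ (MM (x₁ 0) (x₁ 1) (x₂ 0) (x₂ 1) ρ1 ρ2 = 0 ∧ MM (x₁ 0) (x₁ 1) (x₃ 0) (x₃ 1) ρ1 ρ3 = 0 ∧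
      MM (x₂ 0) (x₂ 1) (x₃ 0) (x₃ 1) ρ2 ρ3 = 0) := by
  rintro ⟨m12, m13, m23⟩
  have e12 := MM_rho_ne _ _ _ _ _ _ h12 m12
  have e13 := MM_rho_ne _ _ _ _ _ _ h13 m13
  have e23 := MM_rho_ne _ _ _ _ _ _ h23 m23
  have hP : ρ2 - ρ1 ≠ 0 := sub_ne_zero.2 e12.symm
  obtain ⟨n0, hn0⟩ : ∃ n0, x₂ 0 - x₁ 0 = (ρ2 - ρ1) * n0 := ⟨(x₂ 0 - x₁ 0) / (ρ2 - ρ1), by field_simp⟩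
  obtain ⟨n1, hn1⟩ : ∃ n1, x₂ 1 - x₁ 1 = (ρ2 - ρ1) * n1 := ⟨(x₂ 1 - x₁ 1) / (ρ2 - ρ1), by field_simp⟩
  unfold MM at m12 m13 m23
  have hn : n0^2 + n1^2 = 1 := by
    rw [hn0, hn1] at m12
    have : (ρ2 - ρ1)^2 ≠ 0 := pow_ne_zero _ hP
    apply mul_left_cancel₀ this
    linarith
  have hdot : (ρ2 - ρ1) * ((x₃ 0 - x₁ 0) * n0 + (x₃ 1 - x₁ 1) * n1 - (ρ3 - ρ1)) = 0 := by
    linear_combination (1/2) * (m12 + m13 - m23) - (x₃ 0 - x₁ 0) * hn0 - (x₃ 1 - x₁ 1) * hn1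
  have hdot := (mul_eq_zero.1 hdot).resolve_left hP
  have h5 : (x₃ 0 - x₁ 0 - (ρ3 - ρ1) * n0)^2 + (x₃ 1 - x₁ 1 - (ρ3 - ρ1) * n1)^2 = 0^2 := by
    linear_combination m13 - 2 * (ρ3 - ρ1) * hdot + (ρ3 - ρ1)^2 * hn
  have f0 := sq_zero_left _ _ h5
  have f1 := sq_zero_left _ _ ((add_comm _ _).trans h5)
  have a0 : x₁ 0 = (x₁ 0 - ρ1 * n0) + ρ1 * n0 := by ring
  have a1 : x₁ 1 = (x₁ 1 - ρ1 * n1) + ρ1 * n1 := by ring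
  have b0 : x₂ 0 = (x₁ 0 - ρ1 * n0) + ρ2 * n0 := by linarith
  have b1 : x₂ 1 = (x₁ 1 - ρ1 * n1) + ρ2 * n1 := by linarith
  have c0 : x₃ 0 = (x₁ 0 - ρ1 * n0) + ρ3 * n0 := by linarith
  have c1 : x₃ 1 = (x₁ 1 - ρ1 * n1) + ρ3 * n1 := by linarith
  apply hnd
  refine ⟨!₂[x₁ 0 - ρ1 * n0, x₁ 1 - ρ1 * n1], ⟨⟨(mem_K_iff _ _ _ h₁).2 ?_,
      (mem_K_iff _ _ _ h₂).2 ?_⟩, (mem_K_iff _ _ _ h₃).2 ?_⟩,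
    touch_unique _ _ _ _ ρ1 ρ2 _ _ _ _ h₁ h₂ hn a0 a1 b0 b1 hρ1 hρ2 e12,
    touch_unique _ _ _ _ ρ1 ρ3 _ _ _ _ h₁ h₃ hn a0 a1 c0 c1 hρ1 hρ3 e13,
    touch_unique _ _ _ _ ρ2 ρ3 _ _ _ _ h₂ h₃ hn b0 b1 c0 c1 hρ2 hρ3 e23⟩
  · simp; rw [← hρ1]; linear_combination ρ1^2 * hn
  · rw [b0, b1]; simp; rw [← hρ2]; linear_combination ρ2^2 * hn
  · rw [c0, c1]; simp; rw [← hρ3]; linear_combination ρ3^2 * hn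

lemma comb (A A' B B' C C' : Prop) (hA : ¬ (A ∧ A')) (hB : ¬ (B ∧ B')) (hC : ¬ (C ∧ C'))
    (h1 : ¬ (A ∧ B ∧ C)) (h2 : ¬ (A ∧ B' ∧ C')) (h3 : ¬ (A' ∧ B ∧ C')) (h4 : ¬ (A' ∧ B' ∧ C))
    (n1 n2 n3 n4 b1 b2 b3 b4 p : ℕ) (e1 : n1 = p + b1) (e2 : n2 = p + b2) (e3 : n3 = p + b3)
    (e4 : n4 = p + b4) (l1 : n1 ≤ 2) (l2 : n2 ≤ 2) (l3 : n3 ≤ 2) (l4 : n4 ≤ 2)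
    (i1 : n1 = 1 ↔ (A ∨ B ∨ C)) (i2 : n2 = 1 ↔ (A ∨ B' ∨ C')) (i3 : n3 = 1 ↔ (A' ∨ B ∨ C'))
    (i4 : n4 = 1 ↔ (A' ∨ B' ∨ C)) :
    b1 + b2 + b3 + b4 + p ≤ 8 ∧ b1 + b2 + b3 + b4 + p ≠ 7 ∧ b1 + b2 + b3 + b4 + p ≠ 1 := by
  by_cases A <;> by_cases A' <;> by_cases B <;> by_cases B' <;> by_cases C <;> by_cases C' <;>
    simp_all only [true_and, and_true, false_and, and_false, not_true_eq_false, not_false_eq_true,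
      true_or, or_true, false_or, or_false, iff_true, iff_false] <;> omega

lemma MM_excl (p q p' q' a b : ℝ) (ha : a ≠ 0) (hb : b ≠ 0) :
    ¬ (MM p q p' q' a b = 0 ∧ MM p q p' q' a (-b) = 0) := by
  rintro ⟨h1, h2⟩
  unfold MM at h1 h2
  have : a * b = 0 := by linarith
  exact mul_ne_zero ha hb this

theorem apollonius_classification_bounds (x₁ x₂ x₃ : Pl) (r₁ r₂ r₃ : ℝ)
    (h₁ : 0 < r₁) (h₂ : 0 < r₂) (h₃ : 0 < r₃)
    (hne₁₂ : (x₁, r₁) ≠ (x₂, r₂)) (hne₁₃ : (x₁, r₁) ≠ (x₃, r₃))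
    (hne₂₃ : (x₂, r₂) ≠ (x₃, r₃))
    (hnd : ¬ ∃ p : Pl, p ∈ K x₁ r₁ ∩ K x₂ r₂ ∩ K x₃ r₃ ∧
      (∃! q, q ∈ K x₁ r₁ ∩ K x₂ r₂) ∧ (∃! q, q ∈ K x₁ r₁ ∩ K x₃ r₃) ∧
      (∃! q, q ∈ K x₂ r₂ ∩ K x₃ r₃)) :
    Finite (ApolloniusSolutions ![x₁, x₂, x₃] ![r₁, r₂, r₃]) ∧
    Nat.card (ApolloniusSolutions ![x₁, x₂, x₃] ![r₁, r₂, r₃]) ≤ 8 ∧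
    Nat.card (ApolloniusSolutions ![x₁, x₂, x₃] ![r₁, r₂, r₃]) ≠ 7 ∧
    Nat.card (ApolloniusSolutions ![x₁, x₂, x₃] ![r₁, r₂, r₃]) ≠ 1 := by
  have hdist : ∀ (x y : Pl) (r s ρ σ : ℝ), 0 < r → 0 < s → (x, r) ≠ (y, s) → ρ^2 = r^2 →
      σ^2 = s^2 → ¬ (x 0 = y 0 ∧ x 1 = y 1 ∧ ρ = σ) := by
    rintro x y r s ρ σ hr hs hne e1 e2 ⟨g0, g1, g⟩
    apply hne
    rw [← pl_ext x _ _ g0 g1, pl_ext y _ _ rfl rfl]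
    rw [← g, e1, sq_eq_sq₀ hr.le hs.le] at e2
    rw [e2]
  have sgs : ∀ (b : Bool) (r : ℝ), (sg b * r)^2 = r^2 := by
    intro b r; cases b <;> simp [sg]
  have d12 := fun c : Bool × Bool => hdist x₁ x₂ r₁ r₂ r₁ (sg c.1 * r₂) h₁ h₂ hne₁₂ rfl (sgs _ _)
  have d13 := fun c : Bool × Bool => hdist x₁ x₃ r₁ r₃ r₁ (sg c.2 * r₃) h₁ h₃ hne₁₃ rfl (sgs _ _)
  have d23 := fun c : Bool × Bool => hdist x₂ x₃ r₂ r₃ (sg c.1 * r₂) (sg c.2 * r₃) h₂ h₃ hne₂₃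
    (sgs _ _) (sgs _ _)
  have hnz := fun c : Bool × Bool => not_all_zero x₁ x₂ x₃ r₁ r₂ r₃ h₁ h₂ h₃ r₁ (sg c.1 * r₂)
    (sg c.2 * r₃) rfl (sgs _ _) (sgs _ _) (d12 c) (d13 c) (d23 c) hnd
  have good := fun c : Bool × Bool => good_all _ _ _ _ _ _ _ _ _ (d12 c) (d13 c) (d23 c) (hnz c)
  have finC : ∀ c, (CC x₁ x₂ x₃ r₁ r₂ r₃ c).Finite := fun c => (good c).1
  have finL : ∀ c, Finite (LL x₁ x₂ x₃ r₁ r₂ r₃ c) := fun c => (good c).2.1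
  have finC0 : ∀ c, Finite ↥(CC x₁ x₂ x₃ r₁ r₂ r₃ c \ Z0) := fun c =>
    ((finC c).subset Set.sdiff_subset : (CC x₁ x₂ x₃ r₁ r₂ r₃ c \ Z0).Finite)
  have finCp : ∀ c, Finite ↥(CC x₁ x₂ x₃ r₁ r₂ r₃ c ∩ Z0) := fun c =>
    ((finC c).subset Set.inter_subset_left : (CC x₁ x₂ x₃ r₁ r₂ r₃ c ∩ Z0).Finite)
  obtain ⟨eC⟩ := circles_equiv x₁ x₂ x₃ r₁ r₂ r₃ h₁ h₂ h₃
  obtain ⟨eL⟩ := lines_equiv x₁ x₂ x₃ r₁ r₂ r₃ h₁ h₂ h₃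
  have eP := fun c => points_equiv x₁ x₂ x₃ r₁ r₂ r₃ h₁ h₂ h₃ c
  have f1 := Finite.of_equiv _ eC
  have f2 := Finite.of_equiv _ eL
  have f3 := Finite.of_equiv _ (eP (true, true)).some
  have hfin : Finite (ApolloniusSolutions ![x₁, x₂, x₃] ![r₁, r₂, r₃]) := by
    unfold ApolloniusSolutions; infer_instance
  refine ⟨hfin, ?_⟩
  set p := Nat.card {p : Pl // ∀ i, p ∈ K (![x₁, x₂, x₃] i) (![r₁, r₂, r₃] i)} with hp
  set b := fun c => Nat.card ↥(CC x₁ x₂ x₃ r₁ r₂ r₃ c \ Z0) + Nat.card (LL x₁ x₂ x₃ r₁ r₂ r₃ c)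
    with hb
  set n := fun c => Nat.card (CC x₁ x₂ x₃ r₁ r₂ r₃ c) + Nat.card (LL x₁ x₂ x₃ r₁ r₂ r₃ c) with hn
  have hcard : Nat.card (ApolloniusSolutions ![x₁, x₂, x₃] ![r₁, r₂, r₃]) =
      b (true, true) + b (true, false) + b (false, true) + b (false, false) + p := by
    unfold ApolloniusSolutions
    rw [Nat.card_sum, Nat.card_sum, ← Nat.card_congr eC, ← Nat.card_congr eL, Nat.card_sigma,
      Nat.card_sigma, Fintype.sum_prod_type, Fintype.sum_prod_type]
    simp only [Fintype.sum_bool, hb, ← hp]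
    ring
  have hnb : ∀ c, n c = p + b c := by
    intro c
    have h := Set.ncard_inter_add_ncard_sdiff_eq_ncard (CC x₁ x₂ x₃ r₁ r₂ r₃ c) Z0 (finC c)
    have h' : p = (CC x₁ x₂ x₃ r₁ r₂ r₃ c ∩ Z0).ncard := (Nat.card_congr (eP c).some).symm
    have h2 : n c = (CC x₁ x₂ x₃ r₁ r₂ r₃ c).ncard + Nat.card (LL x₁ x₂ x₃ r₁ r₂ r₃ c) := rfl
    have h3 : b c = (CC x₁ x₂ x₃ r₁ r₂ r₃ c \ Z0).ncard + Nat.card (LL x₁ x₂ x₃ r₁ r₂ r₃ c) := rfl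
    omega
  have hle : ∀ c, n c ≤ 2 := fun c => (good c).2.2.1
  have hiff := fun c => (good c).2.2.2
  have hiff : ∀ c, n c = 1 ↔ _ := hiff
  rw [hcard]
  have st : sg true = 1 := rfl
  have sf : sg false = -1 := by simp [sg]
  have s23 : ∀ u v : ℝ, MM (x₂ 0) (x₂ 1) (x₃ 0) (x₃ 1) (-u) v = MM (x₂ 0) (x₂ 1) (x₃ 0) (x₃ 1) u (-v) := by
    intro u v; unfold MM; ring
  have i1 := hiff (true, true)
  have i2 := hiff (true, false)
  have i3 := hiff (false, true)
  have i4 := hiff (false, false)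
  have z1 := hnz (true, true)
  have z2 := hnz (true, false)
  have z3 := hnz (false, true)
  have z4 := hnz (false, false)
  simp only [st, sf, one_mul, neg_mul, s23, neg_neg] at i1 i2 i3 i4 z1 z2 z3 z4
  exact comb _ _ _ _ _ _ (MM_excl _ _ _ _ _ _ h₁.ne' h₂.ne') (MM_excl _ _ _ _ _ _ h₁.ne' h₃.ne')
    (MM_excl _ _ _ _ _ _ h₂.ne' h₃.ne') z1 z2 z3 z4 _ _ _ _ _ _ _ _ p (hnb _) (hnb _) (hnb _)
    (hnb _) (hle _) (hle _) (hle _) (hle _) i1 i2 i3 i4
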